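/- As p → +∞ the following hold: (i) r_p^{2/(p−1)} · max_{|x| ≤ r_p} |u_p(x)| → √e; (ii) r_p^{4/(p−1)} · p·∫₀^{r_p} |u_p(r)|^{p+1} r dr → 4e; (iii) for every p one has the exact identity u_p'(r_p)·r_p = ∫₀^{r_p} |u_p(r)|^p r dr, and r_p^{2/(p−1)+1} · p·u_p'(r_p) → 4√e; (iv) r_p^{2/(p−1)} · p·∫_{B(0,r_p)} |u_p(x)|^p dx → 8π√e. In particular there exists a > 0 such that a < r_p^{2/(p−1)} ≤ 1 for all large p. -/

import Mathlib

open Real MeasureTheory Set Filter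

noncomputable section

/-- The radial energy functional for the Lane–Emden problem on the unit ball of `ℝ²`
(written in polar coordinates; the common factor `2π` is dropped). -/
def radialEnergy (p : ℝ) (v : ℝ → ℝ) : ℝ :=
  (1 / 2) * (∫ r in (0:ℝ)..1, (deriv v r) ^ 2 * r)
    - (1 / (p + 1)) * ∫ r in (0:ℝ)..1, |v r| ^ (p + 1) * r

/-- The Nehari identity `∫_B |∇v⁺|² = ∫_B |v⁺|^{p+1}` for the positive part,
written in polar coordinates. -/
def nehariPos (p : ℝ) (v : ℝ → ℝ) : Prop :=
  (∫ r in (0:ℝ)..1, (if 0 < v r then (deriv v r) ^ 2 * r else 0))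
    = ∫ r in (0:ℝ)..1, (max (v r) 0) ^ (p + 1) * r

/-- The Nehari identity `∫_B |∇v⁻|² = ∫_B |v⁻|^{p+1}` for the negative part,
written in polar coordinates. -/
def nehariNeg (p : ℝ) (v : ℝ → ℝ) : Prop :=
  (∫ r in (0:ℝ)..1, (if v r < 0 then (deriv v r) ^ 2 * r else 0))
    = ∫ r in (0:ℝ)..1, (max (-v r) 0) ^ (p + 1) * r

/-- A family `p ↦ u p` (for `p > 1`) of least energy nodal radial solutions of the
Lane–Emden problem `−Δu = |u|^{p−1}u` in the unit ball `B ⊆ ℝ²`, `u = 0` on `∂B`,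
described through the radial profile `u p : ℝ → ℝ`.  `rp p ∈ (0,1)` is the nodal
radius, `sp p ∈ (rp p, 1)` is a radius where `u p` attains `‖(u p)⁺‖_∞`; the solution
is negative in the inner nodal region (`u p 0 < 0`), attains `-‖(u p)⁻‖_∞` at `0`,
and minimizes the energy among radial members of the nodal Nehari set. -/
structure LaneEmdenFamily where
  u : ℝ → ℝ → ℝ
  rp : ℝ → ℝ
  sp : ℝ → ℝ
  smooth : ∀ p, 1 < p → ContDiffOn ℝ 2 (u p) (Icc (0:ℝ) 1)
  ode : ∀ p, 1 < p → ∀ r ∈ Ioo (0:ℝ) 1,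
    -deriv (deriv (u p)) r - deriv (u p) r / r = |u p r| ^ (p - 1) * u p r
  derivAtZero : ∀ p, 1 < p → deriv (u p) 0 = 0
  boundary : ∀ p, 1 < p → u p 1 = 0
  center_neg : ∀ p, 1 < p → u p 0 < 0
  min_at_zero : ∀ p, 1 < p → ∀ r ∈ Icc (0:ℝ) 1, u p 0 ≤ u p r
  rp_mem : ∀ p, 1 < p → rp p ∈ Ioo (0:ℝ) 1
  rp_zero : ∀ p, 1 < p → u p (rp p) = 0
  neg_in : ∀ p, 1 < p → ∀ r ∈ Ico (0:ℝ) (rp p), u p r < 0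
  pos_out : ∀ p, 1 < p → ∀ r ∈ Ioo (rp p) 1, 0 < u p r
  sp_mem : ∀ p, 1 < p → sp p ∈ Ioo (rp p) 1
  sp_max : ∀ p, 1 < p → ∀ r ∈ Icc (0:ℝ) 1, u p r ≤ u p (sp p)
  least_energy : ∀ p, 1 < p → ∀ v : ℝ → ℝ,
    ContDiffOn ℝ 1 v (Icc (0:ℝ) 1) → v 1 = 0 →
    (∃ r ∈ Ioo (0:ℝ) 1, 0 < v r) → (∃ r ∈ Ioo (0:ℝ) 1, v r < 0) →
    nehariPos p v → nehariNeg p v →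
    radialEnergy p (u p) ≤ radialEnergy p v

/-- `ε_p⁺`, defined by `(ε_p⁺)⁻² = p · ‖u_p⁺‖_∞^{p−1} = p · u_p(s_p)^{p−1}`. -/
def epsP (F : LaneEmdenFamily) (p : ℝ) : ℝ :=
  1 / Real.sqrt (p * F.u p (F.sp p) ^ (p - 1))

/-- `ε_p⁻`, defined by `(ε_p⁻)⁻² = p · ‖u_p⁻‖_∞^{p−1} = p · |u_p(0)|^{p−1}`. -/
def epsM (F : LaneEmdenFamily) (p : ℝ) : ℝ :=
  1 / Real.sqrt (p * (-F.u p 0) ^ (p - 1))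

/-- A function continuous on `[a, b]` with nonnegative derivative on `(a, b)` satisfies
`f a ≤ f b`. -/
lemma le_of_hasDerivAt_nonneg {f f' : ℝ → ℝ} {a b : ℝ} (hab : a ≤ b)
    (hc : ContinuousOn f (Icc a b)) (hd : ∀ x ∈ Ioo a b, HasDerivAt f (f' x) x)
    (h0 : ∀ x ∈ Ioo a b, 0 ≤ f' x) : f a ≤ f b := by
  have hm : MonotoneOn f (Icc a b) := by
    apply monotoneOn_of_deriv_nonneg (convex_Icc a b) hc
    · rw [interior_Icc]
      exact fun x hx => (hd x hx).differentiableAt.differentiableWithinAt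
    · rw [interior_Icc]
      intro x hx
      rw [(hd x hx).deriv]
      exact h0 x hx
  exact hm (left_mem_Icc.2 hab) (right_mem_Icc.2 hab) hab

/-- `w` is a positive radial solution of `-Δw = w^p` in the disk of radius `ρ`, vanishing on its
boundary, and `F = -r w'` is its flux. -/
structure IsDiskProfile (p ρ : ℝ) (w F : ℝ → ℝ) : Prop where
  one_lt : 1 < p
  radius_pos : 0 < ρ
  contW : ContinuousOn w (Icc 0 ρ)
  contF : ContinuousOn F (Icc 0 ρ)
  flux_zero : F 0 = 0
  derivW : ∀ r ∈ Ioo 0 ρ, HasDerivAt w (-F r / r) r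
  derivF : ∀ r ∈ Ioo 0 ρ, HasDerivAt F (r * w r ^ p) r
  pos : ∀ r ∈ Ico 0 ρ, 0 < w r
  boundary : w ρ = 0

namespace IsDiskProfile

variable {p ρ : ℝ} {w F : ℝ → ℝ}

lemma nonneg (h : IsDiskProfile p ρ w F) {r : ℝ} (hr : r ∈ Icc 0 ρ) : 0 ≤ w r := by
  rcases eq_or_lt_of_le hr.2 with h1 | h1
  · rw [h1, h.boundary]
  · exact (h.pos r ⟨hr.1, h1⟩).le

lemma center_pos (h : IsDiskProfile p ρ w F) : 0 < w 0 := h.pos 0 ⟨le_rfl, h.radius_pos⟩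

lemma continuousOn_rpow (h : IsDiskProfile p ρ w F) {q : ℝ} (hq : 0 ≤ q) :
    ContinuousOn (fun r => w r ^ q) (Icc 0 ρ) :=
  h.contW.rpow_const fun _ _ => Or.inr hq

lemma flux_mono (h : IsDiskProfile p ρ w F) {a b : ℝ} (ha : 0 ≤ a) (hab : a ≤ b) (hb : b ≤ ρ) :
    F a ≤ F b := by
  refine le_of_hasDerivAt_nonneg hab (h.contF.mono (Icc_subset_Icc ha hb))
    (fun x hx => h.derivF x ⟨ha.trans_lt hx.1, hx.2.trans_le hb⟩) fun x hx => ?_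
  have hx0 : 0 < x := ha.trans_lt hx.1
  have := h.pos x ⟨hx0.le, hx.2.trans_le hb⟩
  positivity

lemma flux_nonneg (h : IsDiskProfile p ρ w F) {r : ℝ} (hr : r ∈ Icc 0 ρ) : 0 ≤ F r := by
  have := h.flux_mono le_rfl hr.1 hr.2
  rwa [h.flux_zero] at this

lemma anti (h : IsDiskProfile p ρ w F) {a b : ℝ} (ha : 0 ≤ a) (hab : a ≤ b) (hb : b ≤ ρ) :
    w b ≤ w a := by
  have := le_of_hasDerivAt_nonneg (f := fun x => -w x) (f' := fun x => F x / x) hab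
    (h.contW.mono (Icc_subset_Icc ha hb)).neg
    (fun x hx => by
      exact (h.derivW x ⟨ha.trans_lt hx.1, hx.2.trans_le hb⟩).neg.congr_deriv (by ring))
    (fun x hx => by
      have hx0 : 0 < x := ha.trans_lt hx.1
      have := h.flux_nonneg ⟨hx0.le, (hx.2.trans_le hb).le⟩
      positivity)
  simpa using this

lemma le_flux (h : IsDiskProfile p ρ w F) {r : ℝ} (hr : r ∈ Icc 0 ρ) :
    w r ^ p * (r ^ 2 / 2) ≤ F r := by
  have := le_of_hasDerivAt_nonneg (f := fun x => F x - w r ^ p * (x ^ 2 / 2))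
    (f' := fun x => x * w x ^ p - w r ^ p * x) hr.1
    ((h.contF.mono (Icc_subset_Icc le_rfl hr.2)).sub (by fun_prop))
    (fun x hx => by
      have h2 : HasDerivAt (fun x : ℝ => w r ^ p * (x ^ 2 / 2)) (w r ^ p * x) x :=
        (((hasDerivAt_pow 2 x).div_const 2).const_mul (w r ^ p)).congr_deriv
          (by push_cast; ring)
      exact (h.derivF x ⟨hx.1, hx.2.trans_le hr.2⟩).sub h2)
    (fun x hx => by
      have h1 := h.anti hx.1.le hx.2.le hr.2
      have h2 := Real.rpow_le_rpow (h.nonneg hr) h1 (by linarith [h.one_lt] : 0 ≤ p)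
      nlinarith [hx.1])
  simp [h.flux_zero] at this
  linarith

lemma flux_le_sq (h : IsDiskProfile p ρ w F) {r : ℝ} (hr : r ∈ Icc 0 ρ) :
    F r ≤ w 0 ^ p * (r ^ 2 / 2) := by
  have := le_of_hasDerivAt_nonneg (f := fun x => w 0 ^ p * (x ^ 2 / 2) - F x)
    (f' := fun x => w 0 ^ p * x - x * w x ^ p) hr.1
    (ContinuousOn.sub (by fun_prop) (h.contF.mono (Icc_subset_Icc le_rfl hr.2)))
    (fun x hx => by
      have h2 : HasDerivAt (fun x : ℝ => w 0 ^ p * (x ^ 2 / 2)) (w 0 ^ p * x) x :=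
        (((hasDerivAt_pow 2 x).div_const 2).const_mul (w 0 ^ p)).congr_deriv
          (by push_cast; ring)
      exact h2.sub (h.derivF x ⟨hx.1, hx.2.trans_le hr.2⟩))
    (fun x hx => by
      have hx' : x ≤ ρ := hx.2.le.trans hr.2
      have h1 := h.anti le_rfl hx.1.le hx'
      have h2 := Real.rpow_le_rpow (h.nonneg ⟨hx.1.le, hx'⟩) h1
        (by linarith [h.one_lt] : 0 ≤ p)
      nlinarith [hx.1])
  simp [h.flux_zero] at this
  linarith

lemma hasDerivAt_pohozaev (h : IsDiskProfile p ρ w F) {r : ℝ} (hr : r ∈ Ioo 0 ρ) :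
    HasDerivAt (fun x => F x ^ 2 / 2 + x ^ 2 * w x ^ (p + 1) / (p + 1))
      (2 / (p + 1) * (w r ^ (p + 1) * r)) r := by
  have hp := h.one_lt
  have hw := h.derivW r hr
  have hF := h.derivF r hr
  have hr0 : r ≠ 0 := hr.1.ne'
  have hp1 : p + 1 ≠ 0 := by linarith
  have h1 := hw.rpow_const (p := p + 1) (Or.inr (by linarith))
  have h2 := ((hF.pow 2).div_const 2).add (((hasDerivAt_pow 2 r).mul h1).div_const (p + 1))
  refine h2.congr_deriv ?_
  simp only [add_sub_cancel_right]
  push_cast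
  field_simp
  ring

lemma continuousOn_pohozaev (h : IsDiskProfile p ρ w F) :
    ContinuousOn (fun x => F x ^ 2 / 2 + x ^ 2 * w x ^ (p + 1) / (p + 1)) (Icc 0 ρ) :=
  ((h.contF.pow 2).div_const 2).add
    (((continuousOn_id.pow 2).mul
      (h.continuousOn_rpow (by linarith [h.one_lt]))).div_const _)

/-- The Pohozaev identity on the disk. -/
lemma pohozaev (h : IsDiskProfile p ρ w F) :
    ∫ r in (0:ℝ)..ρ, w r ^ (p + 1) * r = (p + 1) / 4 * F ρ ^ 2 := by
  have hp := h.one_lt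
  have hc : ContinuousOn (fun r => 2 / (p + 1) * (w r ^ (p + 1) * r)) (uIcc 0 ρ) := by
    rw [uIcc_of_le h.radius_pos.le]
    exact continuousOn_const.mul
      ((h.continuousOn_rpow (by linarith)).mul continuousOn_id)
  have := intervalIntegral.integral_eq_sub_of_hasDerivAt_of_le h.radius_pos.le
    h.continuousOn_pohozaev (fun r hr => h.hasDerivAt_pohozaev hr) hc.intervalIntegrable
  rw [intervalIntegral.integral_const_mul, h.flux_zero, h.boundary,
    Real.zero_rpow (by linarith)] at this
  have hp1 : p + 1 ≠ 0 := by linarith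
  field_simp at this
  linarith

lemma integral_eq_flux (h : IsDiskProfile p ρ w F) :
    ∫ r in (0:ℝ)..ρ, w r ^ p * r = F ρ := by
  have hc : ContinuousOn (fun r => w r ^ p * r) (uIcc 0 ρ) := by
    rw [uIcc_of_le h.radius_pos.le]
    exact (h.continuousOn_rpow (by linarith [h.one_lt])).mul continuousOn_id
  have := intervalIntegral.integral_eq_sub_of_hasDerivAt_of_le h.radius_pos.le
    h.contF (fun r hr => (h.derivF r hr).congr_deriv (mul_comm _ _)) hc.intervalIntegrable
  rw [this, h.flux_zero, sub_zero]

lemma flux_le (h : IsDiskProfile p ρ w F) {r : ℝ} (hr : r ∈ Icc 0 ρ) : F r ≤ 4 * w 0 / p := by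
  have hp := h.one_lt
  have hM := h.center_pos
  have h0 := h.flux_nonneg hr
  have := le_of_hasDerivAt_nonneg
    (f := fun x => 2 / (p + 1) * w 0 * F x -
      (F x ^ 2 / 2 + x ^ 2 * w x ^ (p + 1) / (p + 1)))
    (f' := fun x => 2 / (p + 1) * w 0 * (x * w x ^ p) - 2 / (p + 1) * (w x ^ (p + 1) * x)) hr.1
    ((continuousOn_const.mul (h.contF.mono (Icc_subset_Icc le_rfl hr.2))).sub
      (h.continuousOn_pohozaev.mono (Icc_subset_Icc le_rfl hr.2)))
    (fun x hx => ((h.derivF x ⟨hx.1, hx.2.trans_le hr.2⟩).const_mul _).sub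
      (h.hasDerivAt_pohozaev ⟨hx.1, hx.2.trans_le hr.2⟩))
    (fun x hx => by
      have hx0 := hx.1
      have hw := h.pos x ⟨hx.1.le, hx.2.trans_le hr.2⟩
      have h1 := h.anti le_rfl hx.1.le (hx.2.le.trans hr.2)
      rw [Real.rpow_add_one hw.ne']
      have h2 : 2 / (p + 1) * w 0 * (x * w x ^ p) - 2 / (p + 1) * (w x ^ p * w x * x) =
          2 / (p + 1) * x * w x ^ p * (w 0 - w x) := by ring
      rw [h2]
      have := sub_nonneg.2 h1
      positivity)
  simp only [h.flux_zero] at this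
  have h3 : 0 ≤ r ^ 2 * w r ^ (p + 1) / (p + 1) := by
    have := h.nonneg hr
    positivity
  have h4 : F r ^ 2 / 2 ≤ 2 / (p + 1) * w 0 * F r := by
    norm_num at this
    linarith
  rcases eq_or_lt_of_le h0 with h5 | h5
  · rw [← h5]
    positivity
  · have h6 : F r ≤ 4 * w 0 / (p + 1) := by
      have : F r / 2 ≤ 2 / (p + 1) * w 0 := by nlinarith
      calc F r = 2 * (F r / 2) := by ring
        _ ≤ 2 * (2 / (p + 1) * w 0) := by linarith
        _ = _ := by ring
    refine h6.trans ?_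
    gcongr
    linarith

lemma sub_sq_le (h : IsDiskProfile p ρ w F) {r : ℝ} (hr : r ∈ Icc 0 ρ) :
    w 0 - w 0 ^ p * (r ^ 2 / 4) ≤ w r := by
  have := le_of_hasDerivAt_nonneg (f := fun x => w x + w 0 ^ p * (x ^ 2 / 4))
    (f' := fun x => -F x / x + w 0 ^ p * (x / 2)) hr.1
    ((h.contW.mono (Icc_subset_Icc le_rfl hr.2)).add (by fun_prop))
    (fun x hx => by
      have h2 : HasDerivAt (fun x : ℝ => w 0 ^ p * (x ^ 2 / 4)) (w 0 ^ p * (x / 2)) x :=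
        (((hasDerivAt_pow 2 x).div_const 4).const_mul (w 0 ^ p)).congr_deriv
          (by push_cast; ring)
      exact (h.derivW x ⟨hx.1, hx.2.trans_le hr.2⟩).add h2)
    (fun x hx => by
      have hx0 := hx.1
      have h1 := h.flux_le_sq ⟨hx.1.le, hx.2.le.trans hr.2⟩
      have h2 : F x / x ≤ w 0 ^ p * (x / 2) := by
        rw [div_le_iff₀ hx0]
        linarith
      rw [neg_div]
      linarith)
  simp at this
  linarith

lemma sub_log_le (h : IsDiskProfile p ρ w F) {a b c : ℝ} (ha : 0 < a) (hab : a ≤ b) (hb : b ≤ ρ)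
    (hc : ∀ r ∈ Icc a b, F r ≤ c) : w a - c * Real.log (b / a) ≤ w b := by
  have := le_of_hasDerivAt_nonneg (f := fun x => w x + c * Real.log x)
    (f' := fun x => -F x / x + c * x⁻¹) hab
    ((h.contW.mono (Icc_subset_Icc ha.le hb)).add
      (continuousOn_const.mul (Real.continuousOn_log.mono fun x hx => (ha.trans_le hx.1).ne')))
    (fun x hx => (h.derivW x ⟨ha.trans hx.1, hx.2.trans_le hb⟩).add
      ((Real.hasDerivAt_log (ha.trans hx.1).ne').const_mul c))
    (fun x hx => by
      have hx0 := ha.trans hx.1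
      have : -F x / x + c * x⁻¹ = (c - F x) / x := by ring
      rw [this]
      exact div_nonneg (sub_nonneg.2 (hc x ⟨hx.1.le, hx.2.le⟩)) hx0.le)
  rw [Real.log_div (ha.trans_le hab).ne' ha.ne']
  beta_reduce at this
  linarith

lemma le_sub_log (h : IsDiskProfile p ρ w F) {a b c : ℝ} (ha : 0 < a) (hab : a ≤ b) (hb : b ≤ ρ)
    (hc : ∀ r ∈ Icc a b, c ≤ F r) : w b ≤ w a - c * Real.log (b / a) := by
  have := le_of_hasDerivAt_nonneg (f := fun x => -w x - c * Real.log x)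
    (f' := fun x => -(-F x / x) - c * x⁻¹) hab
    ((h.contW.mono (Icc_subset_Icc ha.le hb)).neg.sub
      (continuousOn_const.mul (Real.continuousOn_log.mono fun x hx => (ha.trans_le hx.1).ne')))
    (fun x hx => (h.derivW x ⟨ha.trans hx.1, hx.2.trans_le hb⟩).neg.sub
      ((Real.hasDerivAt_log (ha.trans hx.1).ne').const_mul c))
    (fun x hx => by
      have hx0 := ha.trans hx.1
      have : -(-F x / x) - c * x⁻¹ = (F x - c) / x := by ring
      rw [this]
      exact div_nonneg (sub_nonneg.2 (hc x ⟨hx.1.le, hx.2.le⟩)) hx0.le)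
  rw [Real.log_div (ha.trans_le hab).ne' ha.ne']
  beta_reduce at this
  linarith

lemma riccati (h : IsDiskProfile p ρ w F) {r : ℝ} (hr : r ∈ Icc 0 ρ) :
    2 * w r * F r ≤ (p + 1) / 2 * F r ^ 2 + r ^ 2 * w r ^ (p + 1) := by
  have hp := h.one_lt
  have := le_of_hasDerivAt_nonneg
    (f := fun x => (F x ^ 2 / 2 + x ^ 2 * w x ^ (p + 1) / (p + 1)) - 2 / (p + 1) * (w x * F x))
    (f' := fun x => 2 / (p + 1) * (w x ^ (p + 1) * x) -
      2 / (p + 1) * (-F x / x * F x + w x * (x * w x ^ p))) hr.1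
    ((h.continuousOn_pohozaev.mono (Icc_subset_Icc le_rfl hr.2)).sub
      (continuousOn_const.mul ((h.contW.mul h.contF).mono (Icc_subset_Icc le_rfl hr.2))))
    (fun x hx => (h.hasDerivAt_pohozaev ⟨hx.1, hx.2.trans_le hr.2⟩).sub
      (((h.derivW x ⟨hx.1, hx.2.trans_le hr.2⟩).mul
        (h.derivF x ⟨hx.1, hx.2.trans_le hr.2⟩)).const_mul _))
    (fun x hx => by
      have hx0 := hx.1
      have hw := h.pos x ⟨hx.1.le, hx.2.trans_le hr.2⟩
      rw [Real.rpow_add_one hw.ne']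
      have h2 : 2 / (p + 1) * (w x ^ p * w x * x) -
          2 / (p + 1) * (-F x / x * F x + w x * (x * w x ^ p)) =
          2 / (p + 1) * (F x ^ 2 / x) := by ring
      rw [h2]
      positivity)
  simp only [h.flux_zero] at this
  norm_num at this
  have h1 := mul_le_mul_of_nonneg_left this (by linarith : 0 ≤ p + 1)
  have hp1 : p + 1 ≠ 0 := by linarith
  field_simp at h1
  linarith

/-- Integrated form of the Riccati inequality for the flux. -/
lemma sq_div_flux_le (h : IsDiskProfile p ρ w F) {a b m : ℝ} (ha : 0 < a) (hab : a ≤ b)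
    (hb : b < ρ) (hm : 0 < m) (hmw : m ≤ w b) :
    b ^ 2 / F b ≤ a ^ 2 / F a + (p + 1) / (4 * m) * b ^ 2 := by
  have hp := h.one_lt
  have hFpos : ∀ x ∈ Icc a b, 0 < F x := fun x hx => by
    have hx0 : 0 < x := ha.trans_le hx.1
    have hxρ : x < ρ := hx.2.trans_lt hb
    have := h.pos x ⟨hx0.le, hxρ⟩
    exact lt_of_lt_of_le (by positivity) (h.le_flux ⟨hx0.le, hxρ.le⟩)
  have := le_of_hasDerivAt_nonneg
    (f := fun x => (p + 1) / (4 * m) * x ^ 2 - x ^ 2 / F x)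
    (f' := fun x => (p + 1) / (4 * m) * (2 * x) -
      ((2 * x) * F x - x ^ 2 * (x * w x ^ p)) / F x ^ 2) hab
    (ContinuousOn.sub (by fun_prop) (ContinuousOn.div (by fun_prop)
      (h.contF.mono (Icc_subset_Icc ha.le hb.le)) fun x hx => (hFpos x hx).ne'))
    (fun x hx => by
      have h2 : HasDerivAt (fun x : ℝ => x ^ 2) (2 * x) x := by simpa using hasDerivAt_pow 2 x
      exact (h2.const_mul _).sub (h2.div (h.derivF x ⟨ha.trans hx.1, hx.2.trans hb⟩)
        (hFpos x ⟨hx.1.le, hx.2.le⟩).ne'))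
    (fun x hx => by
      have hx0 := ha.trans hx.1
      have hF := hFpos x ⟨hx.1.le, hx.2.le⟩
      have hw := h.pos x ⟨hx0.le, hx.2.trans hb⟩
      have hwm : m ≤ w x := hmw.trans (h.anti hx0.le hx.2.le hb.le)
      have h1 := h.riccati ⟨hx0.le, (hx.2.trans hb).le⟩
      rw [Real.rpow_add_one hw.ne'] at h1
      rw [sub_nonneg, div_le_iff₀ (by positivity)]
      have h3 : 2 * F x - x ^ 2 * w x ^ p ≤ (p + 1) / (2 * m) * F x ^ 2 := by
        have h4 : 2 * F x - x ^ 2 * w x ^ p ≤ (p + 1) / (2 * w x) * F x ^ 2 := by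
          have h5 : (p + 1) / (2 * w x) * F x ^ 2 = ((p + 1) / 2 * F x ^ 2) / w x := by
            field_simp
          rw [h5, le_div_iff₀ hw]
          linarith
        refine h4.trans ?_
        gcongr
      calc 2 * x * F x - x ^ 2 * (x * w x ^ p) = x * (2 * F x - x ^ 2 * w x ^ p) := by ring
        _ ≤ x * ((p + 1) / (2 * m) * F x ^ 2) := by gcongr
        _ = (p + 1) / (4 * m) * (2 * x) * F x ^ 2 := by ring)
  beta_reduce at this
  have h9 : 0 ≤ (p + 1) / (4 * m) * a ^ 2 := by positivity
  linarith

end IsDiskProfile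

namespace IsDiskProfile

variable {p ρ s : ℝ} {w F : ℝ → ℝ}

/-- Every profile has a concentration scale `s`, with `p w(0)^(p-1) s^2 = 1`. -/
lemma exists_scale (h : IsDiskProfile p ρ w F) :
    ∃ s > 0, w 0 ^ p * s ^ 2 = w 0 / p ∧
      Real.log (ρ ^ 2 * w 0 ^ (p - 1)) = 2 * Real.log (ρ / s) - Real.log p := by
  have hp : 0 < p := by linarith [h.one_lt]
  have hM := h.center_pos
  have hρ := h.radius_pos
  have hA : 0 < p * w 0 ^ (p - 1) := by positivity
  refine ⟨1 / √(p * w 0 ^ (p - 1)), by positivity, ?_, ?_⟩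
  · rw [div_pow, Real.sq_sqrt hA.le]
    have : w 0 ^ p = w 0 ^ (p - 1) * w 0 := by
      rw [← Real.rpow_add_one hM.ne', sub_add_cancel]
    rw [this]
    field_simp
  · rw [div_div_eq_mul_div, div_one, Real.log_mul hρ.ne' (by positivity), Real.log_sqrt hA.le,
      Real.log_mul (by positivity) (by positivity), Real.log_mul hp.ne' (by positivity),
      Real.log_pow]
    push_cast
    ring

lemma scale_lt (h : IsDiskProfile p ρ w F) (hsc : w 0 ^ p * s ^ 2 = w 0 / p) :
    s < ρ := by
  by_contra! hle
  have hp := h.one_lt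
  have hM := h.center_pos
  have hρ := h.radius_pos
  have h1 := h.sub_sq_le ⟨hρ.le, le_rfl⟩
  rw [h.boundary] at h1
  have h2 : w 0 ^ p * ρ ^ 2 ≤ w 0 ^ p * s ^ 2 := by gcongr
  have h3 : w 0 / p ≤ w 0 := div_le_self hM.le hp.le
  linarith

lemma le_of_scale_le (h : IsDiskProfile p ρ w F) (hs : 0 < s)
    (hsc : w 0 ^ p * s ^ 2 = w 0 / p) {r : ℝ} (hr : r ∈ Icc s ρ) :
    w 0 * (1 - 1 / (4 * p) - 4 / p * Real.log (r / s)) ≤ w r := by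
  have hsρ := h.scale_lt hsc
  have h1 := h.sub_sq_le ⟨hs.le, hsρ.le⟩
  have h2 := h.sub_log_le hs hr.1 hr.2 (c := 4 * w 0 / p)
    fun x hx => h.flux_le ⟨hs.le.trans hx.1, hx.2.trans hr.2⟩
  have h3 : w 0 ^ p * (s ^ 2 / 4) = w 0 / p / 4 := by rw [← hsc]; ring
  rw [h3] at h1
  have h4 : w 0 * (1 - 1 / (4 * p) - 4 / p * Real.log (r / s)) =
      w 0 - w 0 / p / 4 - 4 * w 0 / p * Real.log (r / s) := by ring
  linarith

lemma le_log_radius_div_scale (h : IsDiskProfile p ρ w F) (hs : 0 < s)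
    (hsc : w 0 ^ p * s ^ 2 = w 0 / p) : (p - 1 / 4) / 4 ≤ Real.log (ρ / s) := by
  have hp : 0 < p := by linarith [h.one_lt]
  have h1 := h.le_of_scale_le hs hsc ⟨(h.scale_lt hsc).le, le_rfl⟩
  rw [h.boundary] at h1
  have h2 := nonpos_of_mul_nonpos_right h1 h.center_pos
  have h3 : p * (1 - 1 / (4 * p) - 4 / p * Real.log (ρ / s)) =
      p - 1 / 4 - 4 * Real.log (ρ / s) := by
    field_simp
  nlinarith

lemma mul_scale_lt (h : IsDiskProfile p ρ w F) (hs : 0 < s)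
    (hsc : w 0 ^ p * s ^ 2 = w 0 / p) (hδ : 1 / (4 * p) + 4 / p * Real.log p < 1) :
    p * s < ρ := by
  by_contra! hle
  have hp : 0 < p := by linarith [h.one_lt]
  have h1 := h.le_of_scale_le hs hsc ⟨(h.scale_lt hsc).le, le_rfl⟩
  rw [h.boundary] at h1
  have h2 := nonpos_of_mul_nonpos_right h1 h.center_pos
  have h3 : Real.log (ρ / s) ≤ Real.log p :=
    Real.log_le_log (div_pos h.radius_pos hs) (by rwa [div_le_iff₀ hs])
  have h4 : 4 / p * Real.log (ρ / s) ≤ 4 / p * Real.log p := by gcongr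
  linarith

lemma center_le_flux (h : IsDiskProfile p ρ w F) (hs : 0 < s)
    (hsc : w 0 ^ p * s ^ 2 = w 0 / p) (hδ : 1 / (4 * p) + 4 / p * Real.log p < 1) :
    w 0 ≤ ((p + 1) / (4 * p * (1 - (1 / (4 * p) + 4 / p * Real.log p))) + 3 / p ^ 2) *
      (p * F (p * s)) := by
  have hp1 := h.one_lt
  have hp : 0 < p := by linarith
  have hM := h.center_pos
  have hps := h.mul_scale_lt hs hsc hδ
  have hsps : s ≤ p * s := by nlinarith
  set d := 1 - (1 / (4 * p) + 4 / p * Real.log p) with hd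
  have hd0 : 0 < d := by linarith
  have hMd : w 0 * d ≤ w (p * s) := by
    have := h.le_of_scale_le hs hsc ⟨hsps, hps.le⟩
    rwa [mul_div_cancel_right₀ _ hs.ne', sub_sub, ← hd] at this
  have h1 := h.sq_div_flux_le hs hsps hps (by positivity) hMd
  have hws : 0 < w s := h.pos s ⟨hs.le, hsps.trans_lt hps⟩
  have hpow : 3 / 4 * w 0 ^ p ≤ w s ^ p := by
    have h2 := h.sub_sq_le ⟨hs.le, (hsps.trans_lt hps).le⟩
    have h3 : w 0 ^ p * (s ^ 2 / 4) = w 0 / p / 4 := by rw [← hsc]; ring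
    have h4 : w 0 * (1 + -(1 / (4 * p))) ≤ w s := by
      calc w 0 * (1 + -(1 / (4 * p))) = w 0 - w 0 / p / 4 := by ring
        _ ≤ w s := by linarith
    have h5 : 1 / (4 * p) ≤ 1 := by
      rw [div_le_one (by positivity)]; linarith
    have h6 := one_add_mul_self_le_rpow_one_add (s := -(1 / (4 * p))) (by linarith) hp1.le
    have h7 : 1 + p * -(1 / (4 * p)) = 3 / 4 := by field_simp; norm_num
    have h8 : (0:ℝ) ≤ 1 + -(1 / (4 * p)) := by linarith
    rw [h7] at h6
    calc 3 / 4 * w 0 ^ p ≤ (1 + -(1 / (4 * p))) ^ p * w 0 ^ p := by gcongr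
      _ = (w 0 * (1 + -(1 / (4 * p)))) ^ p := by rw [Real.mul_rpow hM.le h8]; ring
      _ ≤ w s ^ p := by gcongr
  have hFs : 3 / 8 * (w 0 / p) ≤ F s := by
    have := h.le_flux ⟨hs.le, (hsps.trans_lt hps).le⟩
    rw [← hsc]
    nlinarith [sq_nonneg s]
  have hFs0 : 0 < F s := lt_of_lt_of_le (by positivity) hFs
  have hFps : 0 < F (p * s) := hFs0.trans_le (h.flux_mono hs.le hsps hps.le)
  have h2 : s ^ 2 / F s ≤ s ^ 2 * (3 * (p / w 0)) := by
    rw [div_eq_mul_inv]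
    gcongr
    rw [inv_le_comm₀ hFs0 (by positivity)]
    refine le_trans ?_ hFs
    rw [mul_inv, inv_div]
    have : 0 < w 0 / p := by positivity
    linarith
  have h3 : p ^ 2 * s ^ 2 / F (p * s) ≤
      s ^ 2 * (3 * (p / w 0) + (p + 1) / (4 * (w 0 * d)) * p ^ 2) := by
    calc _ = (p * s) ^ 2 / F (p * s) := by ring
      _ ≤ _ := h1.trans (by linarith)
  rw [div_le_iff₀ hFps] at h3
  have h4 : p ^ 2 ≤ (3 * (p / w 0) + (p + 1) / (4 * (w 0 * d)) * p ^ 2) * F (p * s) := by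
    have : 0 < s ^ 2 := by positivity
    nlinarith
  have h5 : w 0 / p ^ 2 * p ^ 2 ≤ w 0 / p ^ 2 *
    ((3 * (p / w 0) + (p + 1) / (4 * (w 0 * d)) * p ^ 2) * F (p * s)) := by gcongr
  calc w 0 = w 0 / p ^ 2 * p ^ 2 := by field_simp
    _ ≤ _ := h5
    _ = _ := by
      field_simp
      ring

lemma log_radius_div_scale_le (h : IsDiskProfile p ρ w F) (hs : 0 < s)
    (hsc : w 0 ^ p * s ^ 2 = w 0 / p) (hδ : 1 / (4 * p) + 4 / p * Real.log p < 1) :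
    Real.log (ρ / s) ≤
      ((p + 1) / (4 * p * (1 - (1 / (4 * p) + 4 / p * Real.log p))) + 3 / p ^ 2) * p
        + Real.log p := by
  have hp1 := h.one_lt
  have hp : 0 < p := by linarith
  have hM := h.center_pos
  have hps := h.mul_scale_lt hs hsc hδ
  have hps0 : 0 < p * s := by positivity
  have h1 := h.center_le_flux hs hsc hδ
  have h2 := h.le_sub_log hps0 hps.le le_rfl (c := F (p * s))
    fun r hr => h.flux_mono hps0.le hr.1 hr.2
  rw [h.boundary] at h2
  have h3 := h.anti le_rfl hps0.le hps.le
  have hF : 0 < F (p * s) := by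
    refine (h.flux_nonneg ⟨hps0.le, hps.le⟩).lt_of_ne fun h0 => ?_
    rw [← h0] at h1
    linarith
  have h4 : Real.log (ρ / s) = Real.log (ρ / (p * s)) + Real.log p := by
    rw [← Real.log_mul (by have := h.radius_pos; positivity) hp.ne']
    congr 1
    field_simp
  rw [h4]
  gcongr
  refine le_of_mul_le_mul_left ?_ hF
  linarith

end IsDiskProfile

lemma exp_div_four_le (k : ℝ) : Real.exp k / 4 ≤ Real.exp (k - 17 / 16) := by
  rw [Real.exp_sub]
  gcongr
  have h1 : Real.exp (17 / 16) = Real.exp 1 * Real.exp (1 / 16) := by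
    rw [← Real.exp_add]
    norm_num
  have h2 := Real.exp_bound_div_one_sub_of_interval (x := 1 / 16) (by norm_num) (by norm_num)
  have h3 := Real.exp_one_lt_d9
  rw [h1]
  norm_num at h2
  nlinarith [Real.exp_pos (1 / 16)]

lemma exp_sub_four_le (k : ℝ) : Real.exp (k - 4) ≤ 3 / 128 * Real.exp k := by
  rw [Real.exp_sub, div_le_iff₀ (Real.exp_pos _)]
  have h1 : Real.exp 4 = Real.exp 1 ^ 4 := by
    rw [← Real.exp_nat_mul]
    norm_num
  have h3 : (2.7 : ℝ) ^ 4 ≤ Real.exp 1 ^ 4 := by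
    have := Real.exp_one_gt_d9
    gcongr
    linarith
  have hek := Real.exp_pos k
  rw [h1]
  norm_num at h3
  nlinarith

/-- `u` is a positive radial solution of `-Δu = u^p` in the annulus of inner radius `ρ` and outer
radius `1`, vanishing on its boundary, and `F = r u'` is its flux. -/
structure IsAnnulusProfile (p ρ : ℝ) (u F : ℝ → ℝ) : Prop where
  radius_pos : 0 < ρ
  radius_lt : ρ < 1
  contU : ContinuousOn u (Icc ρ 1)
  contF : ContinuousOn F (Icc ρ 1)
  derivU : ∀ r ∈ Ioo ρ 1, HasDerivAt u (F r / r) r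
  derivF : ∀ r ∈ Ioo ρ 1, HasDerivAt F (-(r * u r ^ p)) r
  pos : ∀ r ∈ Ioo ρ 1, 0 < u r
  inner_boundary : u ρ = 0
  outer_boundary : u 1 = 0

namespace IsAnnulusProfile

variable {p ρ : ℝ} {u F : ℝ → ℝ}

lemma nonneg (h : IsAnnulusProfile p ρ u F) {r : ℝ} (hr : r ∈ Icc ρ 1) : 0 ≤ u r := by
  rcases eq_or_lt_of_le hr.1 with h1 | h1
  · rw [← h1, h.inner_boundary]
  rcases eq_or_lt_of_le hr.2 with h2 | h2
  · rw [h2, h.outer_boundary]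
  · exact (h.pos r ⟨h1, h2⟩).le

lemma flux_anti (h : IsAnnulusProfile p ρ u F) {a b : ℝ} (ha : ρ ≤ a) (hab : a ≤ b)
    (hb : b ≤ 1) : F b ≤ F a := by
  have := le_of_hasDerivAt_nonneg (f := fun x => -F x) (f' := fun x => x * u x ^ p) hab
    (h.contF.mono (Icc_subset_Icc ha hb)).neg
    (fun x hx => (h.derivF x ⟨ha.trans_lt hx.1, hx.2.trans_le hb⟩).neg.congr_deriv (by ring))
    fun x hx => by
      have hx0 : 0 < x := (h.radius_pos.trans_le ha).trans hx.1
      have := h.pos x ⟨ha.trans_lt hx.1, hx.2.trans_le hb⟩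
      positivity
  simpa using this

lemma le_add_log (h : IsAnnulusProfile p ρ u F) {a b : ℝ} (ha : ρ ≤ a) (hab : a ≤ b)
    (hb : b ≤ 1) : u b ≤ u a + F a * Real.log (b / a) := by
  have ha0 := h.radius_pos.trans_le ha
  have := le_of_hasDerivAt_nonneg (f := fun x => F a * Real.log x - u x)
    (f' := fun x => F a * x⁻¹ - F x / x) hab
    ((continuousOn_const.mul (Real.continuousOn_log.mono fun x hx =>
      (ha0.trans_le hx.1).ne')).sub (h.contU.mono (Icc_subset_Icc ha hb)))
    (fun x hx => ((Real.hasDerivAt_log (ha0.trans hx.1).ne').const_mul _).sub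
      (h.derivU x ⟨ha.trans_lt hx.1, hx.2.trans_le hb⟩))
    (fun x hx => by
      have hx0 := ha0.trans hx.1
      have : F a * x⁻¹ - F x / x = (F a - F x) / x := by ring
      rw [this]
      exact div_nonneg (sub_nonneg.2 (h.flux_anti ha hx.1.le (hx.2.le.trans hb))) hx0.le)
  rw [Real.log_div (ha0.trans_le hab).ne' ha0.ne']
  beta_reduce at this
  linarith

lemma add_log_le (h : IsAnnulusProfile p ρ u F) {a b : ℝ} (ha : ρ ≤ a) (hab : a ≤ b)
    (hb : b ≤ 1) : u a + F b * Real.log (b / a) ≤ u b := by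
  have ha0 := h.radius_pos.trans_le ha
  have := le_of_hasDerivAt_nonneg (f := fun x => u x - F b * Real.log x)
    (f' := fun x => F x / x - F b * x⁻¹) hab
    ((h.contU.mono (Icc_subset_Icc ha hb)).sub
      (continuousOn_const.mul (Real.continuousOn_log.mono fun x hx => (ha0.trans_le hx.1).ne')))
    (fun x hx => (h.derivU x ⟨ha.trans_lt hx.1, hx.2.trans_le hb⟩).sub
      ((Real.hasDerivAt_log (ha0.trans hx.1).ne').const_mul _))
    (fun x hx => by
      have hx0 := ha0.trans hx.1
      have : F x / x - F b * x⁻¹ = (F x - F b) / x := by ring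
      rw [this]
      exact div_nonneg (sub_nonneg.2 (h.flux_anti (ha.trans hx.1.le) hx.2.le hb)) hx0.le)
  rw [Real.log_div (ha0.trans_le hab).ne' ha0.ne']
  beta_reduce at this
  linarith

lemma flux_sub_le (h : IsAnnulusProfile p ρ u F) (hp : 0 ≤ p) {a b c : ℝ} (ha : ρ ≤ a)
    (hab : a ≤ b) (hb : b ≤ 1) (hc : ∀ r ∈ Ioo a b, u r ≤ c) :
    F a - F b ≤ c ^ p * ((b ^ 2 - a ^ 2) / 2) := by
  have ha0 := h.radius_pos.trans_le ha
  have := le_of_hasDerivAt_nonneg (f := fun x => F x + c ^ p * (x ^ 2 / 2))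
    (f' := fun x => -(x * u x ^ p) + c ^ p * x) hab
    ((h.contF.mono (Icc_subset_Icc ha hb)).add (by fun_prop))
    (fun x hx => (h.derivF x ⟨ha.trans_lt hx.1, hx.2.trans_le hb⟩).add
      ((((hasDerivAt_pow 2 x).div_const 2).const_mul (c ^ p)).congr_deriv
          (by push_cast; ring)))
    (fun x hx => by
      have hx0 := ha0.trans hx.1
      have h1 := Real.rpow_le_rpow (h.nonneg ⟨ha.trans hx.1.le, hx.2.le.trans hb⟩) (hc x hx) hp
      nlinarith)
  beta_reduce at this
  linarith

lemma le_flux_sub (h : IsAnnulusProfile p ρ u F) (hp : 0 ≤ p) {a b c : ℝ} (ha : ρ ≤ a)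
    (hab : a ≤ b) (hb : b ≤ 1) (hc0 : 0 ≤ c) (hc : ∀ r ∈ Ioo a b, c ≤ u r) :
    c ^ p * ((b ^ 2 - a ^ 2) / 2) ≤ F a - F b := by
  have ha0 := h.radius_pos.trans_le ha
  have := le_of_hasDerivAt_nonneg (f := fun x => -F x - c ^ p * (x ^ 2 / 2))
    (f' := fun x => - -(x * u x ^ p) - c ^ p * x) hab
    ((h.contF.mono (Icc_subset_Icc ha hb)).neg.sub (by fun_prop))
    (fun x hx => (h.derivF x ⟨ha.trans_lt hx.1, hx.2.trans_le hb⟩).neg.sub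
      ((((hasDerivAt_pow 2 x).div_const 2).const_mul (c ^ p)).congr_deriv
          (by push_cast; ring)))
    (fun x hx => by
      have hx0 := ha0.trans hx.1
      have h1 := Real.rpow_le_rpow hc0 (hc x hx) hp
      nlinarith)
  beta_reduce at this
  linarith

lemma le_two_mul (h : IsAnnulusProfile p ρ u F) {a b : ℝ} (ha : ρ ≤ a) (hab : a ≤ b)
    (hb : b ≤ 1) (hba : b ^ 2 ≤ a) : u a ≤ 2 * u b := by
  have ha0 := h.radius_pos.trans_le ha
  have hb0 := ha0.trans_le hab
  have h1 := h.add_log_le ha hab hb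
  have h2 := h.le_add_log (ha.trans hab) hb le_rfl
  rw [h.outer_boundary] at h2
  have h3 : Real.log (b / a) ≤ Real.log (1 / b) := by
    apply Real.log_le_log (by positivity)
    rw [div_le_div_iff₀ ha0 hb0]
    linarith
  have h4 : 0 ≤ Real.log (b / a) := Real.log_nonneg (by rwa [le_div_iff₀ ha0, one_mul])
  have h5 := h.nonneg ⟨ha.trans hab, hb⟩
  rcases le_total 0 (F b) with h6 | h6 <;> nlinarith

set_option maxHeartbeats 1000000 in
/-- If the annulus is exponentially thick in `p`, the initial flux cannot be of the size dictated
by the inner disk. -/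
lemma exponent_lt (h : IsAnnulusProfile p ρ u F) {k : ℝ} (hp : 10 ≤ p)
    (hρ : ρ = Real.exp (-(k * (p - 1) / 2))) (hF1 : 3 / p * Real.exp k ≤ F ρ)
    (hF2 : F ρ ≤ 8 / p * Real.exp k) : k < 14 := by
  by_contra! hk
  have hp0 : 0 < p := by linarith
  obtain ⟨T, hT⟩ : ∃ T, T = k * (p - 1) / 2 := ⟨_, rfl⟩
  rw [← hT] at hρ
  have hT1 : 6 * p ≤ T := by nlinarith
  have hρ0 := h.radius_pos
  have hFpos : 0 < F ρ := lt_of_lt_of_le (by positivity) hF1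
  obtain ⟨a, ha⟩ : ∃ a, a = Real.exp (-T + p / 32) := ⟨_, rfl⟩
  obtain ⟨b, hb⟩ : ∃ b, b = Real.exp ((-T + p / 32) / 2) := ⟨_, rfl⟩
  have hb2 : b ^ 2 = a := by
    rw [hb, ha, ← Real.exp_nat_mul]
    congr 1
    push_cast
    ring
  have hρa : ρ ≤ a := by
    rw [hρ, ha]
    exact Real.exp_le_exp.2 (by linarith)
  have hab : a ≤ b := by
    rw [ha, hb]
    exact Real.exp_le_exp.2 (by linarith)
  have hb1 : b ≤ 1 := by
    rw [hb]
    exact Real.exp_le_one_iff.2 (by linarith)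
  have ha_half : a ≤ 1 / 2 := by
    have h1 : a ≤ Real.exp (-1) := by
      rw [ha]
      exact Real.exp_le_exp.2 (by linarith)
    have h2 : Real.exp (-1) < 0.37 := by linarith [Real.exp_neg_one_lt_d9]
    linarith
  have ha0 : 0 < a := ha ▸ Real.exp_pos _
  have hloga : Real.log (a / ρ) = p / 32 := by
    rw [hρ, ha, ← Real.exp_sub, Real.log_exp]
    ring
  have hlogb : Real.log (b / ρ) = (T + p / 32) / 2 := by
    rw [hρ, hb, ← Real.exp_sub, Real.log_exp]
    ring
  have hlogb' : Real.log (1 / b) = (T - p / 32) / 2 := by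
    rw [one_div, hb, ← Real.exp_neg, Real.log_exp]
    ring
  have hek := Real.exp_pos k
  have hFp : F ρ * (p / 32) ≤ Real.exp k / 4 := by
    calc F ρ * (p / 32) ≤ 8 / p * Real.exp k * (p / 32) := by gcongr
      _ = Real.exp k / 4 := by field_simp; norm_num
  have hFp' : 3 * Real.exp k ≤ F ρ * p := by
    calc 3 * Real.exp k = 3 / p * Real.exp k * p := by field_simp
      _ ≤ _ := by gcongr
  have he1 := exp_div_four_le k
  have he2 := exp_sub_four_le k
  have hpexp : p ≤ Real.exp p := by linarith [Real.add_one_le_exp p]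
  have hFa : F ρ / 2 ≤ F a := by
    have h1 := h.flux_sub_le hp0.le le_rfl hρa (hab.trans hb1) (c := Real.exp (k - 17 / 16))
      fun r hr => by
        have h2 := h.le_add_log le_rfl hr.1.le (hr.2.le.trans (hab.trans hb1))
        rw [h.inner_boundary, zero_add] at h2
        have h3 : Real.log (r / ρ) ≤ p / 32 := by
          rw [← hloga]
          have := hρ0.trans hr.1
          have := hr.2.le
          gcongr
        nlinarith
    rw [← Real.exp_mul] at h1
    have h4 : Real.exp ((k - 17 / 16) * p) * a ^ 2 = Real.exp k * Real.exp (-p) := by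
      rw [ha, ← Real.exp_nat_mul, ← Real.exp_add, ← Real.exp_add]
      congr 1
      push_cast
      rw [hT]
      ring
    have h5 : Real.exp (-p) ≤ 1 / p := by
      rw [Real.exp_neg, one_div]
      gcongr
    have h6 : Real.exp k * Real.exp (-p) ≤ F ρ / 3 := by
      have : 3 / p * Real.exp k = 3 * (Real.exp k * (1 / p)) := by ring
      have : Real.exp k * Real.exp (-p) ≤ Real.exp k * (1 / p) := by gcongr
      linarith
    have h7 : 0 ≤ Real.exp ((k - 17 / 16) * p) * ρ ^ 2 := by positivity
    linarith
  have hua : 2 * Real.exp (k - 4) ≤ u a := by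
    have h1 := h.add_log_le le_rfl hρa (hab.trans hb1)
    rw [hloga, h.inner_boundary] at h1
    nlinarith
  have hdrop := h.le_flux_sub hp0.le hρa hab hb1 (Real.exp_pos (k - 4)).le fun r hr => by
    have hr0 := ha0.trans hr.1
    have h1 := h.le_two_mul hρa hr.1.le (hr.2.le.trans hb1)
      (by rw [← hb2]; have := hr.2.le; gcongr)
    linarith
  have hFb : -(3 * F ρ) ≤ F b := by
    have h1 := h.le_add_log le_rfl (hρa.trans hab) hb1
    have h2 := h.le_add_log (hρa.trans hab) hb1 le_rfl
    rw [h.inner_boundary, hlogb] at h1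
    rw [h.outer_boundary, hlogb'] at h2
    by_contra! h3
    have h4 : F b * ((T - p / 32) / 2) < -(3 * F ρ) * ((T - p / 32) / 2) :=
      mul_lt_mul_of_pos_right h3 (by linarith)
    nlinarith
  have hFa' := h.flux_anti le_rfl hρa (hab.trans hb1)
  rw [hb2, ← Real.exp_mul] at hdrop
  have h1 : Real.exp ((k - 4) * p) * (ρ / 4) ≤ 4 * F ρ := by
    have : ρ / 4 ≤ (a - a ^ 2) / 2 := by
      nlinarith [mul_nonneg ha0.le (sub_nonneg.2 ha_half)]
    calc _ ≤ Real.exp ((k - 4) * p) * ((a - a ^ 2) / 2) := by gcongr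
      _ ≤ _ := by linarith
  have h2 : Real.exp ((k - 4) * p) * ρ = Real.exp k * Real.exp (k * (p - 1) / 2 - 4 * p) := by
    rw [hρ, ← Real.exp_add, ← Real.exp_add, hT]
    congr 1
    ring
  have h3 : 17 ≤ Real.exp (k * (p - 1) / 2 - 4 * p) := by
    have := Real.add_one_le_exp (k * (p - 1) / 2 - 4 * p)
    nlinarith
  have h4 : 8 / p * Real.exp k ≤ Real.exp k := by
    have : 8 / p ≤ 1 := by rw [div_le_one hp0]; linarith
    nlinarith
  nlinarith

end IsAnnulusProfile

namespace LaneEmdenFamily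

/-- The radial flux `r u_p'(r)`, with the one-sided derivative at the endpoints of `[0, 1]`. -/
def flux (F : LaneEmdenFamily) (p r : ℝ) : ℝ := r * derivWithin (F.u p) (Icc 0 1) r

variable (F : LaneEmdenFamily) {p : ℝ}

lemma flux_eq {r : ℝ} (hr : r ∈ Ioo (0:ℝ) 1) : F.flux p r = r * deriv (F.u p) r := by
  rw [flux, derivWithin_of_mem_nhds (Icc_mem_nhds hr.1 hr.2)]

lemma continuousOn_u (hp : 1 < p) : ContinuousOn (F.u p) (Icc 0 1) := (F.smooth p hp).continuousOn

lemma contDiffOn_derivWithin (hp : 1 < p) :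
    ContDiffOn ℝ 1 (derivWithin (F.u p) (Icc 0 1)) (Icc 0 1) :=
  (F.smooth p hp).derivWithin (uniqueDiffOn_Icc zero_lt_one) (by norm_num)

lemma continuousOn_flux (hp : 1 < p) : ContinuousOn (F.flux p) (Icc 0 1) :=
  continuousOn_id.mul (F.contDiffOn_derivWithin hp).continuousOn

lemma hasDerivAt_u (hp : 1 < p) {r : ℝ} (hr : r ∈ Ioo (0:ℝ) 1) :
    HasDerivAt (F.u p) (F.flux p r / r) r := by
  have hd : DifferentiableAt ℝ (F.u p) r :=
    ((F.smooth p hp).differentiableOn (by norm_num)).differentiableAt (Icc_mem_nhds hr.1 hr.2)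
  refine hd.hasDerivAt.congr_deriv ?_
  rw [F.flux_eq hr, mul_div_cancel_left₀ _ hr.1.ne']

lemma hasDerivAt_flux (hp : 1 < p) {r : ℝ} (hr : r ∈ Ioo (0:ℝ) 1) :
    HasDerivAt (F.flux p) (-(r * (|F.u p r| ^ (p - 1) * F.u p r))) r := by
  have hnhds := Icc_mem_nhds hr.1 hr.2
  have hd : DifferentiableAt ℝ (derivWithin (F.u p) (Icc 0 1)) r :=
    ((F.contDiffOn_derivWithin hp).differentiableOn (by norm_num)).differentiableAt hnhds
  have heq : deriv (F.u p) =ᶠ[nhds r] derivWithin (F.u p) (Icc 0 1) := by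
    filter_upwards [isOpen_Ioo.mem_nhds hr] with x hx
    rw [derivWithin_of_mem_nhds (Icc_mem_nhds hx.1 hx.2)]
  have hode := F.ode p hp r hr
  rw [heq.deriv_eq, heq.eq_of_nhds] at hode
  refine ((hasDerivAt_id r).mul hd.hasDerivAt).congr_deriv ?_
  have hr0 := hr.1.ne'
  rw [← hode]
  field_simp
  simp
  ring

lemma isDiskProfile (hp : 1 < p) :
    IsDiskProfile p (F.rp p) (fun r => -F.u p r) (F.flux p) := by
  have hρ := F.rp_mem p hp
  have hsub : Icc 0 (F.rp p) ⊆ Icc 0 1 := Icc_subset_Icc le_rfl hρ.2.le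
  refine ⟨hp, hρ.1, ((F.continuousOn_u hp).mono hsub).neg, (F.continuousOn_flux hp).mono hsub,
    by simp [flux], fun r hr => ?_, fun r hr => ?_,
    fun r hr => neg_pos.2 (F.neg_in p hp r hr), by simp [F.rp_zero p hp]⟩
  · exact (F.hasDerivAt_u hp ⟨hr.1, hr.2.trans hρ.2⟩).neg.congr_deriv (by ring)
  · refine (F.hasDerivAt_flux hp ⟨hr.1, hr.2.trans hρ.2⟩).congr_deriv ?_
    have hneg := F.neg_in p hp r ⟨hr.1.le, hr.2⟩
    have hpow : (-F.u p r) ^ p = (-F.u p r) ^ (p - 1) * (-F.u p r) := by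
      rw [← Real.rpow_add_one (neg_pos.2 hneg).ne', sub_add_cancel]
    rw [abs_of_neg hneg, hpow]
    ring

lemma isAnnulusProfile (hp : 1 < p) :
    IsAnnulusProfile p (F.rp p) (F.u p) (F.flux p) := by
  have hρ := F.rp_mem p hp
  have hsub : Icc (F.rp p) 1 ⊆ Icc 0 1 := Icc_subset_Icc hρ.1.le le_rfl
  refine ⟨hρ.1, hρ.2, (F.continuousOn_u hp).mono hsub, (F.continuousOn_flux hp).mono hsub,
    fun r hr => F.hasDerivAt_u hp ⟨hρ.1.trans hr.1, hr.2⟩, fun r hr => ?_,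
    F.pos_out p hp, F.rp_zero p hp, F.boundary p hp⟩
  refine (F.hasDerivAt_flux hp ⟨hρ.1.trans hr.1, hr.2⟩).congr_deriv ?_
  have hpos := F.pos_out p hp r hr
  rw [abs_of_pos hpos, ← Real.rpow_add_one hpos.ne', sub_add_cancel]

lemma integral_abs_rpow (hp : 1 < p) (q : ℝ) :
    ∫ r in (0:ℝ)..(F.rp p), |F.u p r| ^ q * r = ∫ r in (0:ℝ)..(F.rp p), (-F.u p r) ^ q * r := by
  refine intervalIntegral.integral_congr fun r hr => ?_
  have hρ := F.rp_mem p hp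
  rw [uIcc_of_le hρ.1.le] at hr
  have := (F.isDiskProfile hp).nonneg hr
  rw [abs_of_nonpos (by linarith)]

lemma deriv_mul_eq_integral (hp : 1 < p) :
    deriv (F.u p) (F.rp p) * F.rp p = ∫ r in (0:ℝ)..(F.rp p), |F.u p r| ^ p * r := by
  rw [F.integral_abs_rpow hp, (F.isDiskProfile hp).integral_eq_flux, F.flux_eq (F.rp_mem p hp),
    mul_comm]

lemma sSup_abs (hp : 1 < p) :
    sSup ((fun r => |F.u p r|) '' Icc 0 (F.rp p)) = -F.u p 0 := by
  have hρ := F.rp_mem p hp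
  have hw := F.isDiskProfile hp
  refine IsGreatest.csSup_eq ⟨⟨0, left_mem_Icc.2 hρ.1.le, abs_of_neg (F.center_neg p hp)⟩, ?_⟩
  rintro _ ⟨r, hr, rfl⟩
  have h1 := hw.nonneg hr
  have h2 := hw.anti le_rfl hr.1 hr.2
  beta_reduce
  rwa [abs_of_nonpos (by linarith)]

/-- The rescaled sup norm `r_p^{2/(p-1)} |u_p(0)|`. -/
def scaledCenter (p : ℝ) : ℝ := F.rp p ^ (2 / (p - 1)) * -F.u p 0

/-- The normalised flux `p r_p u_p'(r_p) / |u_p(0)|` through the nodal circle. -/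
def scaledFlux (p : ℝ) : ℝ := p * F.flux p (F.rp p) / -F.u p 0

lemma scaledCenter_mul_scaledFlux (hp : 1 < p) :
    F.scaledCenter p * F.scaledFlux p = F.rp p ^ (2 / (p - 1)) * (p * F.flux p (F.rp p)) := by
  have := (F.center_neg p hp).ne
  rw [scaledCenter, scaledFlux]
  field_simp

lemma log_scaledCenter (hp : 1 < p) :
    Real.log (F.scaledCenter p) = Real.log (F.rp p ^ 2 * (-F.u p 0) ^ (p - 1)) / (p - 1) := by
  have hρ := (F.rp_mem p hp).1
  have hM : 0 < -F.u p 0 := neg_pos.2 (F.center_neg p hp)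
  have hp1 : p - 1 ≠ 0 := by linarith
  rw [scaledCenter, Real.log_mul (by positivity) hM.ne', Real.log_mul (by positivity)
    (by positivity), Real.log_rpow hρ, Real.log_rpow hM, Real.log_pow]
  push_cast
  field_simp

lemma tendsto_log_div_self : Tendsto (fun p : ℝ => Real.log p / p) atTop (nhds 0) :=
  Real.isLittleO_log_id_atTop.tendsto_div_nhds_zero

lemma tendsto_defect :
    Tendsto (fun p : ℝ => 1 / (4 * p) + 4 / p * Real.log p) atTop (nhds 0) := by
  have h1 := (tendsto_inv_atTop_zero (𝕜 := ℝ)).const_mul (1 / 4)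
  have h2 := tendsto_log_div_self.const_mul 4
  have h3 := h1.add h2
  simp only [mul_zero, add_zero] at h3
  refine h3.congr fun p => ?_
  ring

lemma tendsto_recip_flux_bound :
    Tendsto (fun p : ℝ => (p + 1) / (4 * p * (1 - (1 / (4 * p) + 4 / p * Real.log p))) + 3 / p ^ 2)
      atTop (nhds (1 / 4)) := by
  have h1 := tendsto_inv_atTop_zero (𝕜 := ℝ)
  have h2 := ((h1.const_add 1).div (tendsto_defect.const_sub 1) (by norm_num)).const_mul (1 / 4)
  have h3 := h2.add ((h1.pow 2).const_mul 3)
  norm_num at h3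
  refine h3.congr' ?_
  filter_upwards [eventually_gt_atTop 0] with p hp
  rw [mul_comm (4 * p), ← div_div]
  field_simp

lemma eventually_defect_lt : ∀ᶠ p : ℝ in atTop, 1 / (4 * p) + 4 / p * Real.log p < 1 :=
  tendsto_defect.eventually_lt_const zero_lt_one

lemma tendsto_scaledFlux : Tendsto F.scaledFlux atTop (nhds 4) := by
  have hlow := tendsto_recip_flux_bound.inv₀ (by norm_num)
  norm_num only [inv_inv] at hlow
  refine tendsto_of_tendsto_of_tendsto_of_le_of_le' hlow tendsto_const_nhds ?_ ?_
  · filter_upwards [eventually_gt_atTop 1, eventually_defect_lt] with p hp hδ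
    have hw := F.isDiskProfile hp
    obtain ⟨s, hs, hsc, -⟩ := hw.exists_scale
    have h1 := hw.center_le_flux hs hsc hδ
    have h2 := hw.mul_scale_lt hs hsc hδ
    have hp0 : 0 < p := by linarith
    have h3 := hw.flux_mono (by positivity) h2.le le_rfl
    have hM : 0 < -F.u p 0 := neg_pos.2 (F.center_neg p hp)
    have hB : 0 < (p + 1) / (4 * p * (1 - (1 / (4 * p) + 4 / p * Real.log p))) + 3 / p ^ 2 := by
      have := sub_pos.2 hδ
      positivity
    rw [scaledFlux, le_div_iff₀ hM, inv_mul_le_iff₀ hB]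
    refine h1.trans ?_
    gcongr
  · filter_upwards [eventually_gt_atTop 1] with p hp
    have hw := F.isDiskProfile hp
    have hM : 0 < -F.u p 0 := neg_pos.2 (F.center_neg p hp)
    have h1 := hw.flux_le ⟨hw.radius_pos.le, le_rfl⟩
    rw [le_div_iff₀ (by linarith)] at h1
    rw [scaledFlux, div_le_iff₀ hM]
    linarith

lemma tendsto_log_scaledCenter :
    Tendsto (fun p => Real.log (F.scaledCenter p)) atTop (nhds (1 / 2)) := by
  have h1 := tendsto_inv_atTop_zero (𝕜 := ℝ)
  have hlog := tendsto_log_div_self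
  have hden := h1.const_sub 1
  have hlow := ((h1.const_mul (1 / 8)).const_sub (1 / 2)).sub hlog |>.div hden (by norm_num)
  have hup := (tendsto_recip_flux_bound.const_mul 2).add hlog |>.div hden (by norm_num)
  norm_num only at hlow hup
  refine tendsto_of_tendsto_of_tendsto_of_le_of_le' hlow hup ?_ ?_
  · filter_upwards [eventually_gt_atTop 1] with p hp
    have hw := F.isDiskProfile hp
    obtain ⟨s, hs, hsc, hL⟩ := hw.exists_scale
    have h1 := hw.le_log_radius_div_scale hs hsc
    have hp0 : 0 < p := by linarith
    have hp1 : 0 < p - 1 := by linarith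
    have h4 : 0 < 1 - p⁻¹ := sub_pos.2 (inv_lt_one_of_one_lt₀ hp)
    rw [F.log_scaledCenter hp, hL, Pi.div_apply, div_le_div_iff₀ h4 hp1]
    have h2 : (p - 1) = p * (1 - p⁻¹) := by field_simp
    have h3 : (1 / 2 - 1 / 8 * p⁻¹ - Real.log p / p) * p = p / 2 - 1 / 8 - Real.log p := by
      field_simp
    rw [h2, ← mul_assoc, h3]
    gcongr
    linarith
  · filter_upwards [eventually_gt_atTop 1, eventually_defect_lt] with p hp hδ
    have hw := F.isDiskProfile hp
    obtain ⟨s, hs, hsc, hL⟩ := hw.exists_scale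
    have h1 := hw.log_radius_div_scale_le hs hsc hδ
    have hp0 : 0 < p := by linarith
    have hp1 : 0 < p - 1 := by linarith
    have h4 : 0 < 1 - p⁻¹ := sub_pos.2 (inv_lt_one_of_one_lt₀ hp)
    set B := (p + 1) / (4 * p * (1 - (1 / (4 * p) + 4 / p * Real.log p))) + 3 / p ^ 2
    rw [F.log_scaledCenter hp, hL, Pi.div_apply, div_le_div_iff₀ hp1 h4]
    have h2 : (p - 1) = p * (1 - p⁻¹) := by field_simp
    have h3 : (2 * B + Real.log p / p) * p = 2 * B * p + Real.log p := by
      field_simp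
    rw [h2, ← mul_assoc, h3]
    gcongr
    linarith

lemma tendsto_scaledCenter : Tendsto F.scaledCenter atTop (nhds √(Real.exp 1)) := by
  rw [← Real.exp_half]
  refine ((Real.continuous_exp.tendsto _).comp F.tendsto_log_scaledCenter).congr' ?_
  filter_upwards [eventually_gt_atTop 1] with p hp
  have hρ := (F.rp_mem p hp).1
  have hM : 0 < -F.u p 0 := neg_pos.2 (F.center_neg p hp)
  exact Real.exp_log (by rw [scaledCenter]; positivity)

lemma integral_abs_rpow_add_one (hp : 1 < p) :
    F.rp p ^ (4 / (p - 1)) * (p * ∫ r in (0:ℝ)..(F.rp p), |F.u p r| ^ (p + 1) * r) =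
      (F.scaledCenter p * F.scaledFlux p) ^ 2 * ((1 + p⁻¹) / 4) := by
  have hρ := (F.rp_mem p hp).1
  have hp0 : p ≠ 0 := by linarith
  have h1 : F.rp p ^ (4 / (p - 1)) = (F.rp p ^ (2 / (p - 1))) ^ 2 := by
    rw [← Real.rpow_mul_natCast hρ.le]
    congr 1
    push_cast
    ring
  rw [F.integral_abs_rpow hp, (F.isDiskProfile hp).pohozaev, F.scaledCenter_mul_scaledFlux hp, h1]
  field_simp

lemma eventually_lt_scale :
    ∀ᶠ p in atTop, Real.exp (-14) < F.rp p ^ (2 / (p - 1)) := by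
  have hX := F.tendsto_scaledCenter
  have hN := F.tendsto_scaledFlux
  have h1 : (1 : ℝ) < √(Real.exp 1) := by
    rw [← Real.exp_half]
    exact Real.one_lt_exp_iff.2 (by norm_num)
  have h2 : √(Real.exp 1) < 2 := by
    rw [Real.sqrt_lt' (by norm_num)]
    linarith [Real.exp_one_lt_d9]
  filter_upwards [eventually_ge_atTop 10, hX.eventually_const_lt h1, hX.eventually_lt_const h2,
    hN.eventually_const_lt (show (3:ℝ) < 4 by norm_num), eventually_gt_atTop 1]
    with p hp10 hX1 hX2 hN1 hp
  have hρ := (F.rp_mem p hp).1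
  have hp0 : 0 < p := by linarith
  have hp1 : p - 1 ≠ 0 := by linarith
  have hN2 : F.scaledFlux p ≤ 4 := by
    have hw := F.isDiskProfile hp
    have hM : 0 < -F.u p 0 := neg_pos.2 (F.center_neg p hp)
    have h1 := hw.flux_le ⟨hw.radius_pos.le, le_rfl⟩
    rw [le_div_iff₀ (by linarith)] at h1
    rw [scaledFlux, div_le_iff₀ hM]
    linarith
  obtain ⟨k, hk⟩ : ∃ k, k = -(2 / (p - 1) * Real.log (F.rp p)) := ⟨_, rfl⟩
  have hy : F.rp p ^ (2 / (p - 1)) = Real.exp (-k) := by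
    rw [Real.rpow_def_of_pos hρ, hk]
    ring_nf
  have hflux : F.flux p (F.rp p) = F.scaledCenter p * F.scaledFlux p / p * Real.exp k := by
    rw [F.scaledCenter_mul_scaledFlux hp, hy, Real.exp_neg]
    field_simp
  rw [hy, Real.exp_lt_exp, neg_lt_neg_iff]
  refine (F.isAnnulusProfile hp).exponent_lt hp10 ?_ ?_ ?_
  · rw [hk]
    have : -(-(2 / (p - 1) * Real.log (F.rp p)) * (p - 1) / 2) = Real.log (F.rp p) := by
      field_simp
    rw [this, Real.exp_log hρ]
  · rw [hflux]
    gcongr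
    nlinarith
  · rw [hflux]
    gcongr
    nlinarith

end LaneEmdenFamily

/-- Asymptotics in the inner nodal ball `B(0,r_p)` as `p → +∞`:
(i) `r_p^{2/(p−1)} · max_{|x|≤r_p}|u_p| → √e`;
(ii) `r_p^{4/(p−1)} · p∫₀^{r_p}|u_p|^{p+1} r dr → 4e`;
(iii) `u_p'(r_p)·r_p = ∫₀^{r_p}|u_p|^p r dr` exactly, and
`r_p^{2/(p−1)+1} · p·u_p'(r_p) → 4√e`;
(iv) `r_p^{2/(p−1)} · p∫_{B(0,r_p)}|u_p|^p dx → 8π√e` (polar coordinates);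
in particular `a < r_p^{2/(p−1)} ≤ 1` for some `a > 0` and all large `p`. -/
theorem inner_ball_asymptotics (F : LaneEmdenFamily) :
    Tendsto (fun p => F.rp p ^ (2 / (p - 1)) *
        sSup ((fun r => |F.u p r|) '' Icc 0 (F.rp p))) atTop
      (nhds (Real.sqrt (Real.exp 1))) ∧
    Tendsto (fun p => F.rp p ^ (4 / (p - 1)) *
        (p * ∫ r in (0:ℝ)..(F.rp p), |F.u p r| ^ (p + 1) * r)) atTop
      (nhds (4 * Real.exp 1)) ∧
    (∀ p, 1 < p →
      deriv (F.u p) (F.rp p) * F.rp p = ∫ r in (0:ℝ)..(F.rp p), |F.u p r| ^ p * r) ∧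
    Tendsto (fun p => F.rp p ^ (2 / (p - 1) + 1) * (p * deriv (F.u p) (F.rp p))) atTop
      (nhds (4 * Real.sqrt (Real.exp 1))) ∧
    Tendsto (fun p => F.rp p ^ (2 / (p - 1)) *
        (p * (2 * π * ∫ r in (0:ℝ)..(F.rp p), |F.u p r| ^ p * r))) atTop
      (nhds (8 * π * Real.sqrt (Real.exp 1))) ∧
    ∃ a > (0:ℝ), ∃ p₀ > (1:ℝ), ∀ p ≥ p₀,
      a < F.rp p ^ (2 / (p - 1)) ∧ F.rp p ^ (2 / (p - 1)) ≤ 1 := by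
  have hXN := F.tendsto_scaledCenter.mul F.tendsto_scaledFlux
  refine ⟨?_, ?_, fun p hp => F.deriv_mul_eq_integral hp, ?_, ?_, ?_⟩
  · refine F.tendsto_scaledCenter.congr' ?_
    filter_upwards [eventually_gt_atTop 1] with p hp
    rw [F.sSup_abs hp, LaneEmdenFamily.scaledCenter]
  · have h := (hXN.pow 2).mul (((tendsto_inv_atTop_zero (𝕜 := ℝ)).const_add 1).div_const 4)
    have he : (√(Real.exp 1) * 4) ^ 2 * ((1 + 0) / 4) = 4 * Real.exp 1 := by
      rw [mul_pow, Real.sq_sqrt (Real.exp_pos 1).le]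
      ring
    rw [he] at h
    refine h.congr' ?_
    filter_upwards [eventually_gt_atTop 1] with p hp
    exact (F.integral_abs_rpow_add_one hp).symm
  · rw [mul_comm 4]
    refine hXN.congr' ?_
    filter_upwards [eventually_gt_atTop 1] with p hp
    have hρ := F.rp_mem p hp
    rw [F.scaledCenter_mul_scaledFlux hp, F.flux_eq hρ, Real.rpow_add_one hρ.1.ne']
    ring
  · have h := hXN.const_mul (2 * π)
    have he : 2 * π * (√(Real.exp 1) * 4) = 8 * π * √(Real.exp 1) := by ring
    rw [he] at h
    refine h.congr' ?_
    filter_upwards [eventually_gt_atTop 1] with p hp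
    rw [F.scaledCenter_mul_scaledFlux hp, F.integral_abs_rpow hp,
      (F.isDiskProfile hp).integral_eq_flux]
    ring
  · obtain ⟨p₁, hp₁⟩ := eventually_atTop.1 F.eventually_lt_scale
    refine ⟨Real.exp (-14), Real.exp_pos _, max p₁ 2, by
      rw [gt_iff_lt, lt_max_iff]; right; norm_num, fun p hp => ?_⟩
    have hp2 : 2 ≤ p := (le_max_right _ _).trans hp
    have hρ := F.rp_mem p (by linarith)
    exact ⟨hp₁ p ((le_max_left _ _).trans hp),
      Real.rpow_le_one hρ.1.le hρ.2.le (div_nonneg zero_le_two (by linarith))⟩
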